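/- There exist δ₀ > 0 and C > 0, depending only on p, μ, v_±, s and the profile ṽ, such that for every T > 0, every δ ≤ δ₀, and every classical solution (Φ,Ψ) of the integrated perturbation system on ℝ × [0,T] satisfying the a priori smallness assumption with parameter δ, for all t ∈ [0,T]: ∫₀ᵗ ‖Ψ_ξ(τ)‖² dτ ≤ C ‖(Φ₀,Ψ₀)‖₁². -/

import Mathlib

open MeasureTheory Filter Topology Set

noncomputable section

noncomputable def L2sq (w : ℝ → ℝ) : ℝ := ∫ ξ : ℝ, (w ξ) ^ 2

noncomputable def HkSq (k : ℕ) (w : ℝ → ℝ) : ℝ :=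
  ∑ j ∈ Finset.range (k + 1), L2sq (iteratedDeriv j w)

noncomputable def pairHkSq (k : ℕ) (F G : ℝ → ℝ) : ℝ := HkSq k F + HkSq k G

/-- The nonlinear remainder `G = (g'(v) - g'(ṽ))Φ_ξξ + (g'(v) - g'(ṽ) - g''(ṽ)Φ_ξ)ṽ_ξ`
with `v = ṽ + Φ_ξ`. -/
noncomputable def Gterm (g tv φ : ℝ → ℝ) (ξ : ℝ) : ℝ :=
  (deriv g (tv ξ + deriv φ ξ) - deriv g (tv ξ)) * iteratedDeriv 2 φ ξ +
    (deriv g (tv ξ + deriv φ ξ) - deriv g (tv ξ)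
      - deriv (deriv g) (tv ξ) * deriv φ ξ) * deriv tv ξ

/-- The relative pressure `p(v|ṽ) = p(v) - p(ṽ) - p'(ṽ)(v - ṽ)` with `v = ṽ + Φ_ξ`. -/
noncomputable def prel (p tv φ : ℝ → ℝ) (ξ : ℝ) : ℝ :=
  p (tv ξ + deriv φ ξ) - p (tv ξ) - deriv p (tv ξ) * deriv φ ξ

/-- A classical solution of the integrated perturbation system on `ℝ × [0,T]`:
`C⁴` in `ξ`, `C¹` in `t` with continuous mixed derivatives `∂_t ∂_ξ^j` (`j ≤ 3`),
satisfying both equations pointwise, with square-integrable `ξ`-derivatives up to order 4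
(`L²`-norms continuous in `t`) and derivatives up to order 3 decaying at spatial infinity,
uniformly in `t`. -/
structure IsClassicalSolution (p g tv : ℝ → ℝ) (s T : ℝ) (Φ Ψ : ℝ → ℝ → ℝ) : Prop where
  regΦ : ∀ t ∈ Set.Icc (0:ℝ) T, ContDiff ℝ 4 (Φ t)
  regΨ : ∀ t ∈ Set.Icc (0:ℝ) T, ContDiff ℝ 4 (Ψ t)
  tdiffΦ : ∀ j : ℕ, j ≤ 3 → ∀ t ∈ Set.Icc (0:ℝ) T, ∀ ξ : ℝ,
    DifferentiableAt ℝ (fun τ => iteratedDeriv j (Φ τ) ξ) t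
  tdiffΨ : ∀ j : ℕ, j ≤ 3 → ∀ t ∈ Set.Icc (0:ℝ) T, ∀ ξ : ℝ,
    DifferentiableAt ℝ (fun τ => iteratedDeriv j (Ψ τ) ξ) t
  mixContΦ : ∀ j : ℕ, j ≤ 3 → ContinuousOn
    (fun q : ℝ × ℝ => deriv (fun τ => iteratedDeriv j (Φ τ) q.2) q.1)
    (Set.Icc (0:ℝ) T ×ˢ (Set.univ : Set ℝ))
  mixContΨ : ∀ j : ℕ, j ≤ 3 → ContinuousOn
    (fun q : ℝ × ℝ => deriv (fun τ => iteratedDeriv j (Ψ τ) q.2) q.1)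
    (Set.Icc (0:ℝ) T ×ˢ (Set.univ : Set ℝ))
  spContΦ : ∀ j : ℕ, j ≤ 4 → ContinuousOn
    (fun q : ℝ × ℝ => iteratedDeriv j (Φ q.1) q.2)
    (Set.Icc (0:ℝ) T ×ˢ (Set.univ : Set ℝ))
  spContΨ : ∀ j : ℕ, j ≤ 4 → ContinuousOn
    (fun q : ℝ × ℝ => iteratedDeriv j (Ψ q.1) q.2)
    (Set.Icc (0:ℝ) T ×ˢ (Set.univ : Set ℝ))
  eq1 : ∀ t ∈ Set.Icc (0:ℝ) T, ∀ ξ : ℝ,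
    deriv (fun τ => Φ τ ξ) t - s * deriv (Φ t) ξ - deriv (Ψ t) ξ
        - deriv g (tv ξ) * iteratedDeriv 2 (Φ t) ξ
        - deriv (deriv g) (tv ξ) * deriv tv ξ * deriv (Φ t) ξ
      = Gterm g tv (Φ t) ξ
  eq2 : ∀ t ∈ Set.Icc (0:ℝ) T, ∀ ξ : ℝ,
    deriv (fun τ => Ψ τ ξ) t - s * deriv (Ψ t) ξ + deriv p (tv ξ) * deriv (Φ t) ξ
      = -prel p tv (Φ t) ξ
  sqIntΦ : ∀ j : ℕ, j ≤ 4 → ∀ t ∈ Set.Icc (0:ℝ) T,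
    MeasureTheory.Integrable (fun ξ : ℝ => (iteratedDeriv j (Φ t) ξ) ^ 2)
  sqIntΨ : ∀ j : ℕ, j ≤ 4 → ∀ t ∈ Set.Icc (0:ℝ) T,
    MeasureTheory.Integrable (fun ξ : ℝ => (iteratedDeriv j (Ψ t) ξ) ^ 2)
  l2ContΦ : ∀ j : ℕ, j ≤ 4 →
    ContinuousOn (fun t => L2sq (iteratedDeriv j (Φ t))) (Set.Icc (0:ℝ) T)
  l2ContΨ : ∀ j : ℕ, j ≤ 4 →
    ContinuousOn (fun t => L2sq (iteratedDeriv j (Ψ t))) (Set.Icc (0:ℝ) T)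
  decayΦ : ∀ j : ℕ, j ≤ 3 → ∀ ε > (0:ℝ), ∃ R : ℝ, ∀ t ∈ Set.Icc (0:ℝ) T, ∀ ξ : ℝ,
    R ≤ |ξ| → |iteratedDeriv j (Φ t) ξ| < ε
  decayΨ : ∀ j : ℕ, j ≤ 3 → ∀ ε > (0:ℝ), ∃ R : ℝ, ∀ t ∈ Set.Icc (0:ℝ) T, ∀ ξ : ℝ,
    R ≤ |ξ| → |iteratedDeriv j (Ψ t) ξ| < ε

theorem exists_taylor_bounds {h : ℝ → ℝ} (hh : ContDiffOn ℝ (⊤ : ℕ∞) h (Ioi 0)) {α β : ℝ}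
    (hα : 0 < α) :
    ∃ M : ℝ, 0 ≤ M ∧ ∀ u ∈ Icc α β, |h u| ≤ M ∧ |deriv h u| ≤ M ∧ ∀ v ∈ Icc α β,
      |h v - h u| ≤ M * |v - u| ∧ |h v - h u - deriv h u * (v - u)| ≤ M * (v - u) ^ 2 := by
  have h1 : ContDiffOn ℝ (⊤ : ℕ∞) (deriv h) (Ioi 0) :=
    hh.deriv_of_isOpen isOpen_Ioi (by simp)
  have h2 : ContDiffOn ℝ (⊤ : ℕ∞) (deriv (deriv h)) (Ioi 0) :=
    h1.deriv_of_isOpen isOpen_Ioi (by simp)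
  have hsub : Icc α β ⊆ Ioi 0 := fun x hx => lt_of_lt_of_le hα hx.1
  have hder : ∀ f : ℝ → ℝ, ContDiffOn ℝ (⊤ : ℕ∞) f (Ioi 0) → ∀ x ∈ Icc α β,
      HasDerivAt f (deriv f x) x := fun f hf x hx =>
    ((hf.differentiableOn (by simp)).differentiableAt (Ioi_mem_nhds (hsub hx))).hasDerivAt
  obtain ⟨M0, hM0⟩ := isCompact_Icc.exists_bound_of_continuousOn (hh.continuousOn.mono hsub)
  obtain ⟨M1, hM1⟩ := isCompact_Icc.exists_bound_of_continuousOn (h1.continuousOn.mono hsub)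
  obtain ⟨M2, hM2⟩ := isCompact_Icc.exists_bound_of_continuousOn (h2.continuousOn.mono hsub)
  have lip : ∀ f : ℝ → ℝ, ContDiffOn ℝ (⊤ : ℕ∞) f (Ioi 0) → ∀ K : ℝ,
      (∀ x ∈ Icc α β, ‖deriv f x‖ ≤ K) → ∀ u ∈ Icc α β, ∀ v ∈ Icc α β,
      |f v - f u| ≤ K * |v - u| := fun f hf K hK u hu v hv =>
    (convex_Icc α β).norm_image_sub_le_of_norm_hasDerivWithin_le
      (fun x hx => (hder f hf x hx).hasDerivWithinAt) hK hu hv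
  refine ⟨max 0 (max M0 (max M1 M2)), le_max_left _ _, fun u hu => ⟨(hM0 u hu).trans (by simp),
    (hM1 u hu).trans (by simp), fun v hv => ⟨?_, ?_⟩⟩⟩
  · exact lip h hh _ (fun x hx => (hM1 x hx).trans (by simp)) u hu v hv
  · have hseg : uIcc u v ⊆ Icc α β := (ordConnected_Icc).uIcc_subset hu hv
    have key := (convex_uIcc u v).norm_image_sub_le_of_norm_hasDerivWithin_le
      (f := fun w => h w - deriv h u * (w - u)) (f' := fun w => deriv h w - deriv h u)
      (C := max 0 (max M0 (max M1 M2)) * |v - u|) (x := u) (y := v) ?_ ?_ left_mem_uIcc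
      right_mem_uIcc
    · have e : (v - u) ^ 2 = |v - u| * |v - u| := by rw [← sq, sq_abs]
      rw [e, ← mul_assoc]
      refine le_of_eq_of_le ?_ key
      rw [Real.norm_eq_abs]
      congr 1
      ring
    · intro x hx
      have := (hder h hh x (hseg hx)).sub (((hasDerivAt_id x).sub_const u).const_mul (deriv h u))
      exact (this.congr_deriv (by simp)).hasDerivWithinAt
    · intro x hx
      refine (lip (deriv h) h1 (max 0 (max M0 (max M1 M2))) (fun x hx => (hM2 x hx).trans (by simp)) u hu x
        (hseg hx)).trans ?_
      gcongr ?_ * ?_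
      exact abs_sub_left_of_mem_uIcc hx

theorem sq_le_L2sq_add_L2sq_deriv {w : ℝ → ℝ} (hw : ContDiff ℝ 1 w)
    (h0 : Integrable fun ξ => w ξ ^ 2) (h1 : Integrable fun ξ => deriv w ξ ^ 2)
    (hlim : Tendsto w atBot (𝓝 0)) (ξ : ℝ) : w ξ ^ 2 ≤ L2sq w + L2sq (deriv w) := by
  have hd : ∀ x, HasDerivAt w (deriv w x) x := fun x =>
    (hw.differentiable (by simp) x).hasDerivAt
  have hc : Continuous (deriv w) := hw.continuous_deriv le_rfl
  have hint : Integrable fun x => 2 * w x * deriv w x := by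
    refine (h0.add h1).mono' (by have := hw.continuous; fun_prop) (ae_of_all _ fun x => ?_)
    rw [Real.norm_eq_abs, abs_le]
    simp only [Pi.add_apply]
    constructor <;> nlinarith [sq_nonneg (w x + deriv w x), sq_nonneg (w x - deriv w x)]
  have key := integral_Iic_of_hasDerivAt_of_tendsto' (a := ξ) (m := 0)
    (f := fun x => w x ^ 2) (f' := fun x => 2 * w x * deriv w x)
    (fun x _ => ((hd x).pow 2).congr_deriv (by simp)) hint.integrableOn (by simpa using hlim.pow 2)
  rw [sub_zero] at key
  rw [← key, L2sq, L2sq, ← integral_add h0 h1]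
  refine (setIntegral_mono_on hint.integrableOn (h0.add h1).integrableOn measurableSet_Iic
    fun x _ => ?_).trans (setIntegral_le_integral (h0.add h1) (ae_of_all _ fun x => ?_))
  · simp only [Pi.add_apply]
    nlinarith [sq_nonneg (w x - deriv w x)]
  · simp only [Pi.add_apply, Pi.zero_apply]
    positivity

/-- Exchange of a time derivative and a space derivative. -/
theorem hasDerivAt_comm_of_continuousOn {f f' ft ft' : ℝ → ℝ → ℝ} {T : ℝ}
    (hf : ∀ t ∈ Icc 0 T, ∀ ξ, HasDerivAt (f t) (f' t ξ) ξ)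
    (hfc : ∀ t ∈ Icc 0 T, Continuous (f' t))
    (hft : ∀ t ∈ Icc 0 T, ∀ ξ, HasDerivAt (fun τ => f τ ξ) (ft t ξ) t)
    (hft' : ∀ t ∈ Icc 0 T, ∀ ξ, HasDerivAt (fun τ => f' τ ξ) (ft' t ξ) t)
    (hcont : ContinuousOn (fun q : ℝ × ℝ => ft' q.1 q.2) (Icc 0 T ×ˢ univ))
    {t : ℝ} (ht : t ∈ Ioo 0 T) (ξ : ℝ) : HasDerivAt (ft t) (ft' t ξ) ξ := by
  have htI : t ∈ Icc 0 T := Ioo_subset_Icc_self ht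
  have hc : Continuous (ft' t) := by
    rw [← continuousOn_univ]
    exact hcont.comp (f := fun y : ℝ => (t, y)) (by fun_prop) fun y _ => ⟨htI, mem_univ _⟩
  have hkey : ∀ y, ft t y = ft t ξ + ∫ z in ξ..y, ft' t z := by
    intro y
    obtain ⟨C, hC⟩ := (isCompact_Icc.prod (isCompact_uIcc (a := ξ) (b := y))).exists_bound_of_continuousOn
      (hcont.mono (prod_mono_right (subset_univ _)))
    have hnhds : Icc 0 T ∈ 𝓝 t := Icc_mem_nhds ht.1 ht.2
    have h1 := (intervalIntegral.hasDerivAt_integral_of_dominated_loc_of_deriv_le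
      (μ := volume) (a := ξ) (b := y) (bound := fun _ => C) (F := f') (F' := ft') hnhds
      (by filter_upwards [hnhds] with τ hτ using (hfc τ hτ).aestronglyMeasurable)
      ((hfc t htI).intervalIntegrable _ _) hc.aestronglyMeasurable
      (ae_of_all _ fun z hz τ hτ => hC (τ, z) ⟨hτ, uIoc_subset_uIcc hz⟩)
      (by simp) (ae_of_all _ fun z _ τ hτ => hft' τ hτ z)).2
    have h2 : HasDerivAt (fun τ => ∫ z in ξ..y, f' τ z) (ft t y - ft t ξ) t := by
      refine ((hft t htI y).sub (hft t htI ξ)).congr_of_eventuallyEq ?_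
      filter_upwards [hnhds] with τ hτ
      exact intervalIntegral.integral_eq_sub_of_hasDerivAt (fun x _ => hf τ hτ x)
        ((hfc τ hτ).intervalIntegrable _ _)
    linarith [h1.unique h2]
  have h3 := (hc.integral_hasStrictDerivAt ξ ξ).hasDerivAt.const_add (ft t ξ)
  exact h3.congr_of_eventuallyEq (Eventually.of_forall hkey)

theorem integrable_prod_of_continuousOn {h : ℝ → ℝ → ℝ} {t : ℝ}
    (hc : ContinuousOn (fun q : ℝ × ℝ => h q.1 q.2) (Icc 0 t ×ˢ univ)) (a b : ℝ) :
    Integrable (Function.uncurry h)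
      ((volume.restrict (Ioc 0 t)).prod (volume.restrict (Ioc a b))) := by
  rw [Measure.prod_restrict, ← Measure.volume_eq_prod]
  have h1 : IntegrableOn (Function.uncurry h) (Icc 0 t ×ˢ Icc a b) volume :=
    (hc.mono (prod_mono_right (subset_univ _))).integrableOn_compact
      (isCompact_Icc.prod isCompact_Icc)
  exact h1.mono_set (prod_mono Ioc_subset_Icc_self Ioc_subset_Icc_self)

/-- A local dissipation inequality `∂ₜ e + w ≤ ∂_ξ F` integrated over a space-time box. -/
theorem box_dissipation_estimate {e et w F F' : ℝ → ℝ → ℝ} {h0 : ℝ → ℝ} {t a b ε : ℝ}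
    (ht : 0 ≤ t) (hab : a ≤ b)
    (hetc : ContinuousOn (fun q : ℝ × ℝ => et q.1 q.2) (Icc 0 t ×ˢ univ))
    (hwc : ContinuousOn (fun q : ℝ × ℝ => w q.1 q.2) (Icc 0 t ×ˢ univ))
    (he : ∀ τ ∈ Icc 0 t, ∀ ξ, HasDerivAt (fun σ => e σ ξ) (et τ ξ) τ)
    (hF : ∀ τ ∈ Ioo 0 t, ∀ ξ, HasDerivAt (F τ) (F' τ ξ) ξ)
    (hineq : ∀ τ ∈ Ioo 0 t, ∀ ξ, et τ ξ + w τ ξ ≤ F' τ ξ)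
    (hbd : ∀ τ ∈ Ioo 0 t, F τ b - F τ a ≤ ε)
    (hpos : ∀ ξ, 0 ≤ e t ξ) (hinit : ∀ ξ, e 0 ξ ≤ h0 ξ) (hh0 : Integrable h0) :
    ∫ τ in (0:ℝ)..t, ∫ ξ in a..b, w τ ξ ≤ (∫ ξ in a..b, h0 ξ) + ε * t := by
  have iet := integrable_prod_of_continuousOn hetc a b
  have iw := integrable_prod_of_continuousOn hwc a b
  have slice : ∀ h : ℝ → ℝ → ℝ, ContinuousOn (fun q : ℝ × ℝ => h q.1 q.2) (Icc 0 t ×ˢ univ) →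
      ∀ τ ∈ Icc 0 t, Continuous (h τ) := fun h hc τ hτ => by
    rw [← continuousOn_univ]
    exact hc.comp (f := fun y : ℝ => (τ, y)) (by fun_prop) fun y _ => ⟨hτ, mem_univ _⟩
  have i1 : IntervalIntegrable (fun τ => ∫ ξ in a..b, et τ ξ) volume 0 t := by
    rw [intervalIntegrable_iff_integrableOn_Ioc_of_le ht]
    simp only [intervalIntegral.integral_of_le hab]
    exact iet.integral_prod_left
  have i2 : IntervalIntegrable (fun τ => ∫ ξ in a..b, w τ ξ) volume 0 t := by
    rw [intervalIntegrable_iff_integrableOn_Ioc_of_le ht]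
    simp only [intervalIntegral.integral_of_le hab]
    exact iw.integral_prod_left
  have i3 : IntervalIntegrable (fun ξ => ∫ τ in (0:ℝ)..t, et τ ξ) volume a b := by
    rw [intervalIntegrable_iff_integrableOn_Ioc_of_le hab]
    simp only [intervalIntegral.integral_of_le ht]
    exact iet.integral_prod_right
  have swap : ∫ τ in (0:ℝ)..t, ∫ ξ in a..b, et τ ξ = ∫ ξ in a..b, ∫ τ in (0:ℝ)..t, et τ ξ := by
    simp only [intervalIntegral.integral_of_le ht, intervalIntegral.integral_of_le hab]
    exact integral_integral_swap iet
  have step : ∀ τ ∈ Ioo 0 t, (∫ ξ in a..b, et τ ξ) + (∫ ξ in a..b, w τ ξ) ≤ ε := by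
    intro τ hτ
    have hτ' := Ioo_subset_Icc_self hτ
    have c1 := slice et hetc τ hτ'
    have c2 := slice w hwc τ hτ'
    rw [← intervalIntegral.integral_add (c1.intervalIntegrable _ _) (c2.intervalIntegrable _ _)]
    refine le_trans ?_ (hbd τ hτ)
    exact intervalIntegral.integral_le_sub_of_hasDeriv_right_of_le hab
      (fun x _ => (hF τ hτ x).continuousAt.continuousWithinAt)
      (fun x _ => (hF τ hτ x).hasDerivWithinAt)
      ((c1.add c2).continuousOn.integrableOn_compact isCompact_Icc) (fun x _ => hineq τ hτ x)
  have h1 := intervalIntegral.integral_mono_on_of_le_Ioo ht (i1.add i2)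
    (intervalIntegrable_const (c := ε)) step
  rw [intervalIntegral.integral_add i1 i2, swap, intervalIntegral.integral_const, sub_zero,
    smul_eq_mul] at h1
  have h2 : ∫ ξ in a..b, -h0 ξ ≤ ∫ ξ in a..b, ∫ τ in (0:ℝ)..t, et τ ξ := by
    refine intervalIntegral.integral_mono_on hab hh0.neg.intervalIntegrable i3 fun ξ _ => ?_
    have hcξ : ContinuousOn (fun τ => et τ ξ) (Icc 0 t) :=
      hetc.comp (f := fun τ : ℝ => (τ, ξ)) (by fun_prop) fun τ hτ => ⟨hτ, mem_univ _⟩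
    rw [intervalIntegral.integral_eq_sub_of_hasDerivAt
      (fun τ hτ => he τ (by rwa [uIcc_of_le ht] at hτ) ξ)
      (hcξ.intervalIntegrable_of_Icc ht)]
    linarith [hpos ξ, hinit ξ]
  rw [intervalIntegral.integral_neg] at h2
  linarith

/-- A local dissipation inequality integrated over `[0,t] × ℝ`, the flux vanishing at infinity. -/
theorem dissipation_estimate {e et w F F' : ℝ → ℝ → ℝ} {h0 : ℝ → ℝ} {t : ℝ}
    (ht : 0 ≤ t)
    (hetc : ContinuousOn (fun q : ℝ × ℝ => et q.1 q.2) (Icc 0 t ×ˢ univ))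
    (hwc : ContinuousOn (fun q : ℝ × ℝ => w q.1 q.2) (Icc 0 t ×ˢ univ))
    (he : ∀ τ ∈ Icc 0 t, ∀ ξ, HasDerivAt (fun σ => e σ ξ) (et τ ξ) τ)
    (hF : ∀ τ ∈ Ioo 0 t, ∀ ξ, HasDerivAt (F τ) (F' τ ξ) ξ)
    (hineq : ∀ τ ∈ Ioo 0 t, ∀ ξ, et τ ξ + w τ ξ ≤ F' τ ξ)
    (hbd : ∀ ε > 0, ∃ R : ℝ, ∀ τ ∈ Ioo 0 t, ∀ ξ, R ≤ |ξ| → |F τ ξ| ≤ ε)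
    (hpos : ∀ ξ, 0 ≤ e t ξ) (hinit : ∀ ξ, e 0 ξ ≤ h0 ξ) (hh0 : Integrable h0)
    (hh0pos : ∀ ξ, 0 ≤ h0 ξ) (hwpos : ∀ τ ξ, 0 ≤ w τ ξ)
    (hwint : ∀ τ ∈ Icc 0 t, Integrable (w τ))
    (hwL : ContinuousOn (fun τ => ∫ ξ, w τ ξ) (Icc 0 t)) :
    ∫ τ in (0:ℝ)..t, ∫ ξ, w τ ξ ≤ ∫ ξ, h0 ξ := by
  refine le_of_forall_pos_le_add fun ε hε => ?_
  obtain ⟨R, hR⟩ := hbd (ε / (2 * (t + 1))) (by positivity)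
  have hlim : Tendsto (fun r : ℝ => ∫ τ in (0:ℝ)..t, ∫ ξ in (-r)..r, w τ ξ) atTop
      (𝓝 (∫ τ in (0:ℝ)..t, ∫ ξ, w τ ξ)) := by
    refine intervalIntegral.tendsto_integral_filter_of_dominated_convergence
      (fun τ => ∫ ξ, w τ ξ) ?_ ?_ (hwL.intervalIntegrable_of_Icc ht) ?_
    · filter_upwards [eventually_ge_atTop 0] with r hr
      rw [uIoc_of_le ht]
      have := (integrable_prod_of_continuousOn hwc (-r) r).integral_prod_left
      simp only [intervalIntegral.integral_of_le (neg_le_self hr)]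
      exact this.1
    · filter_upwards [eventually_ge_atTop 0] with r hr
      refine ae_of_all _ fun τ hτ => ?_
      rw [uIoc_of_le ht] at hτ
      rw [intervalIntegral.integral_of_le (neg_le_self hr), Real.norm_of_nonneg
        (integral_nonneg fun ξ => hwpos τ ξ)]
      exact setIntegral_le_integral (hwint τ (Ioc_subset_Icc_self hτ))
        (ae_of_all _ fun ξ => hwpos τ ξ)
    · refine ae_of_all _ fun τ hτ => ?_
      rw [uIoc_of_le ht] at hτ
      exact intervalIntegral_tendsto_integral (hwint τ (Ioc_subset_Icc_self hτ))
        tendsto_neg_atTop_atBot tendsto_id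
  refine le_of_tendsto hlim ?_
  filter_upwards [eventually_ge_atTop (max R 0)] with r hr
  have hr0 : 0 ≤ r := (le_max_right _ _).trans hr
  have hrR : R ≤ |r| := ((le_max_left _ _).trans hr).trans (le_abs_self r)
  have key := box_dissipation_estimate (ε := ε / (t + 1)) ht (neg_le_self hr0) hetc hwc he hF hineq
    (fun τ hτ => by
      have h1 := abs_le.1 (hR τ hτ r hrR)
      have h2 := abs_le.1 (hR τ hτ (-r) (by rwa [abs_neg]))
      have h3 : ε / (t + 1) = 2 * (ε / (2 * (t + 1))) := by field_simp
      linarith) hpos hinit hh0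
  have h4 : ∫ ξ in (-r)..r, h0 ξ ≤ ∫ ξ, h0 ξ := by
    rw [intervalIntegral.integral_of_le (neg_le_self hr0)]
    exact setIntegral_le_integral hh0 (ae_of_all _ hh0pos)
  have h5 : ε / (t + 1) * t ≤ ε := by
    rw [div_mul_eq_mul_div, div_le_iff₀ (by positivity)]
    nlinarith
  linarith

/-- Smoothness of the coefficients along the profile and the bounds on them which the energy
method uses; `r` is the admissible size of the perturbation `Φ_ξ` of the specific volume. -/
structure CoefficientBounds (p g tv : ℝ → ℝ) (s r m M : ℝ) : Prop where
  m_pos : 0 < m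
  one_le : 1 ≤ M
  speed : |s| ≤ M
  profile : ∀ ξ, HasDerivAt tv (deriv tv ξ) ξ
  visc_diff : ∀ ξ, HasDerivAt (deriv g) (deriv (deriv g) (tv ξ)) (tv ξ)
  visc_lower : ∀ ξ, m ≤ deriv g (tv ξ)
  visc_upper : ∀ ξ, |deriv g (tv ξ)| ≤ M
  visc_deriv : ∀ ξ, |deriv (deriv g) (tv ξ) * deriv tv ξ| ≤ M
  visc_lip : ∀ ξ x, |x| ≤ r → |deriv g (tv ξ + x) - deriv g (tv ξ)| ≤ M * |x|
  visc_taylor : ∀ ξ x, |x| ≤ r →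
    |(deriv g (tv ξ + x) - deriv g (tv ξ) - deriv (deriv g) (tv ξ) * x) * deriv tv ξ| ≤ M * x ^ 2
  pres_diff : ∀ ξ x, |x| ≤ r → HasDerivAt p (deriv p (tv ξ + x)) (tv ξ + x)
  pres_diff2 : ∀ ξ, HasDerivAt (deriv p) (deriv (deriv p) (tv ξ)) (tv ξ)
  pres_neg : ∀ ξ, deriv p (tv ξ) < 0
  pres_bound : ∀ ξ, |deriv p (tv ξ)| ≤ M
  weight_bound : ∀ ξ, (-deriv p (tv ξ))⁻¹ ≤ M
  weight_deriv : ∀ ξ, |(-deriv p (tv ξ))⁻¹ * (deriv (deriv p) (tv ξ) * deriv tv ξ)| ≤ M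
  weight_sign : ∀ ξ, 0 ≤ s * (deriv (deriv p) (tv ξ) * deriv tv ξ)
  pres_taylor : ∀ ξ x, |x| ≤ r → |p (tv ξ + x) - p (tv ξ) - deriv p (tv ξ) * x| ≤ M * x ^ 2
  pres_lip : ∀ ξ x, |x| ≤ r → |deriv p (tv ξ + x) - deriv p (tv ξ)| ≤ M * |x|
  pres_deriv_taylor : ∀ ξ x, |x| ≤ r →
    |(deriv p (tv ξ + x) - deriv p (tv ξ) - deriv (deriv p) (tv ξ) * x) * deriv tv ξ| ≤ M * x ^ 2

theorem exists_coefficientBounds {p μ g tv : ℝ → ℝ} {vp vm s : ℝ}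
    (hp : ContDiffOn ℝ (⊤ : ℕ∞) p (Ioi 0)) (hpd : ∀ v ∈ Ioi (0:ℝ), deriv p v < 0)
    (hpdd : ∀ v ∈ Ioi (0:ℝ), 0 ≤ deriv (deriv p) v)
    (hmu : ContDiffOn ℝ (⊤ : ℕ∞) μ (Ioi 0)) (hmu_pos : ∀ v ∈ Ioi (0:ℝ), 0 < μ v)
    (hvp : 0 < vp) (hs : s < 0) (hg : ∀ z ∈ Ioi (0:ℝ), HasDerivAt g (μ z / z) z)
    (htv : ContDiff ℝ (⊤ : ℕ∞) tv) (htv_mem : ∀ ξ, tv ξ ∈ Ioo vp vm)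
    (htv_dec : ∀ ξ, deriv tv ξ < 0) (htv_bdd : ∃ M : ℝ, ∀ ξ, |deriv tv ξ| ≤ M) :
    ∃ m M : ℝ, CoefficientBounds p g tv s (vp / 2) m M := by
  have hgd : ∀ z ∈ Ioi (0:ℝ), deriv g z = μ z / z := fun z hz => (hg z hz).deriv
  have hgs : ContDiffOn ℝ (⊤ : ℕ∞) (deriv g) (Ioi 0) :=
    (hmu.div contDiffOn_id fun x hx => ne_of_gt hx).congr hgd
  have hps : ContDiffOn ℝ (⊤ : ℕ∞) (deriv p) (Ioi 0) := hp.deriv_of_isOpen isOpen_Ioi (by simp)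
  have hder : ∀ f : ℝ → ℝ, ContDiffOn ℝ (⊤ : ℕ∞) f (Ioi 0) → ∀ x, 0 < x →
      HasDerivAt f (deriv f x) x := fun f hf x hx =>
    ((hf.differentiableOn (by simp)).differentiableAt (Ioi_mem_nhds hx)).hasDerivAt
  have hv : (0:ℝ) < vp / 2 := by positivity
  have hsub : Icc (vp / 2) (vm + vp / 2) ⊆ Ioi 0 := fun x hx => lt_of_lt_of_le hv hx.1
  have hmem : ∀ ξ x, |x| ≤ vp / 2 → tv ξ + x ∈ Icc (vp / 2) (vm + vp / 2) := by
    intro ξ x hx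
    have := abs_le.1 hx
    have := htv_mem ξ
    constructor <;> linarith [this.1, this.2]
  have hmem0 : ∀ ξ, tv ξ ∈ Icc (vp / 2) (vm + vp / 2) := fun ξ => by
    simpa using hmem ξ 0 (by simpa using hv.le)
  have hpos : ∀ ξ, 0 < tv ξ := fun ξ => hsub (hmem0 ξ)
  obtain ⟨Mg, hMg, hgB⟩ := exists_taylor_bounds hgs (β := vm + vp / 2) hv
  obtain ⟨Mp, hMp, hpB⟩ := exists_taylor_bounds hp (β := vm + vp / 2) hv
  obtain ⟨Mq, hMq, hqB⟩ := exists_taylor_bounds hps (β := vm + vp / 2) hv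
  obtain ⟨M0, hM0⟩ := htv_bdd
  have hM00 : 0 ≤ M0 := (abs_nonneg _).trans (hM0 0)
  obtain ⟨Ma, hMa⟩ := (isCompact_Icc (a := vp / 2) (b := vm + vp / 2)).exists_bound_of_continuousOn
    (f := fun v => (-deriv p v)⁻¹)
    (((hps.continuousOn.mono hsub).neg).inv₀ fun x hx => by
      simpa using (hpd x (hsub hx)).ne)
  have hMa0 : 0 ≤ Ma := (norm_nonneg _).trans (hMa _ (hmem0 0))
  obtain ⟨c, hc, hcmin⟩ := (isCompact_Icc (a := vp / 2) (b := vm + vp / 2)).exists_isMinOn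
    ⟨_, hmem0 0⟩ (hgs.continuousOn.mono hsub)
  have n1 := mul_nonneg hMg hM00
  have n2 := mul_nonneg hMq hM00
  have n3 := mul_nonneg hMa0 n2
  have n4 := abs_nonneg s
  have mulb : ∀ {a b α β : ℝ}, |a| ≤ α → |b| ≤ β → |a * b| ≤ α * β := fun {a b α β} ha hb => by
    rw [abs_mul]
    exact mul_le_mul ha hb (abs_nonneg _) ((abs_nonneg _).trans ha)
  refine ⟨deriv g c, 1 + |s| + Mg + Mg * M0 + Mp + Mq + Mq * M0 + Ma + Ma * (Mq * M0), ?_⟩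
  have wk : ∀ {a K y : ℝ}, a ≤ K * y → 0 ≤ y →
      K ≤ 1 + |s| + Mg + Mg * M0 + Mp + Mq + Mq * M0 + Ma + Ma * (Mq * M0) →
      a ≤ (1 + |s| + Mg + Mg * M0 + Mp + Mq + Mq * M0 + Ma + Ma * (Mq * M0)) * y :=
    fun h hy hK => h.trans (mul_le_mul_of_nonneg_right hK hy)
  constructor
  · rw [hgd c (hsub hc)]
    exact div_pos (hmu_pos c (hsub hc)) (hsub hc)
  · linarith
  · linarith
  · exact fun ξ => (htv.differentiable (by simp) ξ).hasDerivAt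
  · exact fun ξ => hder _ hgs _ (hpos ξ)
  · exact fun ξ => hcmin (hmem0 ξ)
  · exact fun ξ => ((hgB _ (hmem0 ξ)).1).trans (by linarith)
  · exact fun ξ => (mulb (hgB _ (hmem0 ξ)).2.1 (hM0 ξ)).trans (by linarith)
  · intro ξ x hx
    have := ((hgB _ (hmem0 ξ)).2.2 _ (hmem ξ x hx)).1
    rw [add_sub_cancel_left] at this
    exact wk this (abs_nonneg _) (by linarith)
  · intro ξ x hx
    have := ((hgB _ (hmem0 ξ)).2.2 _ (hmem ξ x hx)).2
    rw [add_sub_cancel_left] at this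
    exact wk ((mulb this (hM0 ξ)).trans (by linarith) : _ ≤ Mg * M0 * x ^ 2) (sq_nonneg _)
      (by linarith)
  · exact fun ξ x hx => hder _ hp _ (hsub (hmem ξ x hx))
  · exact fun ξ => hder _ hps _ (hpos ξ)
  · exact fun ξ => hpd _ (hpos ξ)
  · exact fun ξ => ((hqB _ (hmem0 ξ)).1).trans (by linarith)
  · exact fun ξ => ((le_abs_self _).trans (hMa _ (hmem0 ξ))).trans (by linarith)
  · exact fun ξ => (mulb (hMa _ (hmem0 ξ)) (mulb (hqB _ (hmem0 ξ)).2.1 (hM0 ξ))).trans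
      (by linarith)
  · exact fun ξ => mul_nonneg_of_nonpos_of_nonpos hs.le
      (mul_nonpos_of_nonneg_of_nonpos (hpdd _ (hpos ξ)) (htv_dec ξ).le)
  · intro ξ x hx
    have := ((hpB _ (hmem0 ξ)).2.2 _ (hmem ξ x hx)).2
    rw [add_sub_cancel_left] at this
    exact wk this (sq_nonneg _) (by linarith)
  · intro ξ x hx
    have := ((hqB _ (hmem0 ξ)).2.2 _ (hmem ξ x hx)).1
    rw [add_sub_cancel_left] at this
    exact wk this (abs_nonneg _) (by linarith)
  · intro ξ x hx
    have := ((hqB _ (hmem0 ξ)).2.2 _ (hmem ξ x hx)).2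
    rw [add_sub_cancel_left] at this
    exact wk ((mulb this (hM0 ξ)).trans (by linarith) : _ ≤ Mq * M0 * x ^ 2) (sq_nonneg _)
      (by linarith)

theorem abs_mul_le_of_abs_le {a b α β : ℝ} (ha : |a| ≤ α) (hb : |b| ≤ β) :
    |a * b| ≤ α * β := by
  rw [abs_mul]
  exact mul_le_mul ha hb (abs_nonneg _) ((abs_nonneg _).trans ha)

/-- The coercivity of the dissipation in absolute values `u = |Φ_ξ|`, `v = |Φ_ξξ|`,
`w = |Ψ_ξ|`. -/
theorem dissipation_abs_le {m M η A B u v w : ℝ} (hm : 0 < m) (hM : 1 ≤ M) (hη : 0 ≤ η)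
    (hA0 : 0 ≤ A) (hB0 : 0 ≤ B) (hB : 4 * M ^ 2 ≤ B * m)
    (hA : 2 * (B * (M ^ 2 / m) + M ^ 2 * (1 + B) ^ 2 + M) ≤ A * m)
    (hηA : η * (10 * (A + B + 1) * M ^ 2) ≤ A * m / 2)
    (hηB : η * (10 * (A + B + 1) * M ^ 2) ≤ B * m / 2)
    (hu : 0 ≤ u) (hv : 0 ≤ v) :
    A * (-m * u ^ 2 + η * (M * (u * (u + v))) + M * (η * (M * u ^ 2)))
      + B * (-m * v ^ 2 + M * (u * v) + M * (η * (u + v)) * v + M * (u * w)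
        + M * (η * (M * (u * (u + v)))))
      - w ^ 2 + (M * v + M * u) * w + M * (u * (u + v)) * η + M * u ^ 2 + η * (M * u ^ 2)
      ≤ -(1 / 2) * w ^ 2 := by
  have e1 : B * (M * (u * v)) ≤ B * (m * v ^ 2 / 4 + M ^ 2 / m * u ^ 2) := by
    refine mul_le_mul_of_nonneg_left ?_ hB0
    have : m * v ^ 2 / 4 + M ^ 2 / m * u ^ 2 - M * (u * v) = (m * v / 2 - M * u) ^ 2 / m := by
      field_simp
      ring
    have h2 : 0 ≤ (m * v / 2 - M * u) ^ 2 / m := by positivity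
    linarith
  have e2 : M * v * w ≤ w ^ 2 / 4 + M ^ 2 * v ^ 2 := by nlinarith [sq_nonneg (w / 2 - M * v)]
  have e3 : M * (1 + B) * u * w ≤ w ^ 2 / 4 + M ^ 2 * (1 + B) ^ 2 * u ^ 2 := by
    nlinarith [sq_nonneg (w / 2 - M * (1 + B) * u)]
  have hMM : M ≤ M ^ 2 := by nlinarith
  have hS1 : u * (u + v) ≤ 2 * (u ^ 2 + v ^ 2) := by nlinarith [sq_nonneg (u - v)]
  have hS2 : (u + v) * v ≤ 2 * (u ^ 2 + v ^ 2) := by nlinarith [sq_nonneg (u - v)]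
  have hS3 : u ^ 2 ≤ u ^ 2 + v ^ 2 := by nlinarith
  have b1 : M * (u * (u + v)) ≤ M ^ 2 * (2 * (u ^ 2 + v ^ 2)) := by gcongr
  have b2 : M * ((u + v) * v) ≤ M ^ 2 * (2 * (u ^ 2 + v ^ 2)) := by gcongr
  have b3 : M ^ 2 * (u * (u + v)) ≤ M ^ 2 * (2 * (u ^ 2 + v ^ 2)) := by gcongr
  have b4 : M ^ 2 * u ^ 2 ≤ M ^ 2 * (u ^ 2 + v ^ 2) := by gcongr
  have b5 : M * u ^ 2 ≤ M ^ 2 * (u ^ 2 + v ^ 2) := by gcongr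
  have e4 : A * (M * (u * (u + v)) + M ^ 2 * u ^ 2)
      + B * (M * ((u + v) * v) + M ^ 2 * (u * (u + v))) + M * (u * (u + v)) + M * u ^ 2
      ≤ 10 * (A + B + 1) * M ^ 2 * (u ^ 2 + v ^ 2) := by
    have h1 := mul_le_mul_of_nonneg_left (add_le_add b1 b4) hA0
    have h2 := mul_le_mul_of_nonneg_left (add_le_add b2 b3) hB0
    have h3 : 0 ≤ M ^ 2 * (u ^ 2 + v ^ 2) := by positivity
    nlinarith [mul_nonneg hA0 h3, mul_nonneg hB0 h3]
  have e5 := mul_le_mul_of_nonneg_left e4 hη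
  have e6 := mul_le_mul_of_nonneg_right hηA (sq_nonneg u)
  have e7 := mul_le_mul_of_nonneg_right hηB (sq_nonneg v)
  have e8 := mul_le_mul_of_nonneg_right hA (sq_nonneg u)
  have e9 := mul_le_mul_of_nonneg_right hB (sq_nonneg v)
  linarith

theorem dissipation_le {m M η A B s k k₁ a b a₁ pp G pr prd f q x y z : ℝ}
    (hm : 0 < m) (hM : 1 ≤ M) (hη : 0 ≤ η)
    (hA0 : 0 ≤ A) (hB0 : 0 ≤ B) (hB : 4 * M ^ 2 ≤ B * m)
    (hA : 2 * (B * (M ^ 2 / m) + M ^ 2 * (1 + B) ^ 2 + M) ≤ A * m)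
    (hηA : η * (10 * (A + B + 1) * M ^ 2) ≤ A * m / 2)
    (hηB : η * (10 * (A + B + 1) * M ^ 2) ≤ B * m / 2)
    (hk : m ≤ k) (hk' : |k| ≤ M) (hk₁ : |k₁| ≤ M) (ha : |a| ≤ M) (hb : |b| ≤ M)
    (hpp : |pp| ≤ M) (ha₁ : 0 ≤ s * a₁)
    (hG : |G| ≤ M * (|x| * (|x| + |y|))) (hpr : |pr| ≤ M * |x| ^ 2)
    (hprd : |prd| ≤ M * (|x| * (|x| + |y|)))
    (hf : |f| ≤ η) (hq : |q| ≤ η) (hx : |x| ≤ η) (hz : |z| ≤ η) :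
    A * (-k * x ^ 2 - s / 2 * a₁ * q ^ 2 + f * G - a * (q * pr))
      + B * (-k * y ^ 2 - k₁ * (x * y) - G * y - s / 2 * a₁ * z ^ 2 - b * (x * z)
        - a * (z * prd))
      - z ^ 2 - (k * y + k₁ * x) * z - G * z - pp * x ^ 2 - x * pr ≤ -(1 / 2) * z ^ 2 := by
  have key := dissipation_abs_le (w := |z|) hm hM hη hA0 hB0 hB hA hηA hηB (abs_nonneg x)
    (abs_nonneg y)
  have hM0 : 0 ≤ M := by linarith
  have hx2 : |x ^ 2| ≤ |x| ^ 2 := (abs_pow x 2).le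
  have t1 := (abs_le.1 (abs_mul_le_of_abs_le hf hG)).2
  have t2 := (abs_le.1 (abs_mul_le_of_abs_le ha (abs_mul_le_of_abs_le hq hpr))).1
  have t3 := (abs_le.1 (abs_mul_le_of_abs_le hk₁ (abs_mul x y).le)).1
  have hG' : |G| ≤ M * (η * (|x| + |y|)) := hG.trans (by gcongr)
  have t4 := (abs_le.1 (abs_mul_le_of_abs_le hG' (le_refl |y|))).1
  have t5 := (abs_le.1 (abs_mul_le_of_abs_le hb (abs_mul x z).le)).1
  have t6 := (abs_le.1 (abs_mul_le_of_abs_le ha (abs_mul_le_of_abs_le hz hprd))).1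
  have t7 := (abs_le.1 (abs_mul_le_of_abs_le ((abs_add_le _ _).trans (add_le_add
    (abs_mul_le_of_abs_le hk' (le_refl |y|)) (abs_mul_le_of_abs_le hk₁ (le_refl |x|))))
    (le_refl |z|))).1
  have t8 := (abs_le.1 (abs_mul_le_of_abs_le hG hz)).1
  have t9 := (abs_le.1 (abs_mul_le_of_abs_le hpp hx2)).1
  have t10 := (abs_le.1 (abs_mul_le_of_abs_le hx hpr)).1
  have t11 := mul_le_mul_of_nonneg_right hk (sq_nonneg x)
  have t12 := mul_le_mul_of_nonneg_right hk (sq_nonneg y)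
  have t13 := mul_nonneg ha₁ (sq_nonneg q)
  have t14 := mul_nonneg ha₁ (sq_nonneg z)
  have hAt : A * (-k * x ^ 2 - s / 2 * a₁ * q ^ 2 + f * G - a * (q * pr)) ≤
      A * (-m * |x| ^ 2 + η * (M * (|x| * (|x| + |y|))) + M * (η * (M * |x| ^ 2))) := by
    refine mul_le_mul_of_nonneg_left ?_ hA0
    rw [sq_abs] at t2 ⊢
    linarith
  have hBt : B * (-k * y ^ 2 - k₁ * (x * y) - G * y - s / 2 * a₁ * z ^ 2 - b * (x * z)
        - a * (z * prd)) ≤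
      B * (-m * |y| ^ 2 + M * (|x| * |y|) + M * (η * (|x| + |y|)) * |y| + M * (|x| * |z|)
        + M * (η * (M * (|x| * (|x| + |y|))))) := by
    refine mul_le_mul_of_nonneg_left ?_ hB0
    rw [sq_abs y]
    linarith
  rw [sq_abs z] at key
  linarith

/-- Energy density. -/
def energyDensity (A B a f x q z : ℝ) : ℝ :=
  A / 2 * (f ^ 2 + a * q ^ 2) + B / 2 * (x ^ 2 + a * z ^ 2) - f * z

/-- Spatial flux of the energy density. -/
def energyFlux (A B s k a f x q z P Q : ℝ) : ℝ :=
  A * (s / 2 * f ^ 2 + k * f * x + s / 2 * a * q ^ 2 + f * q)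
    + B * (x * P - s / 2 * x ^ 2 + s / 2 * a * z ^ 2) - f * Q

theorem energyDensity_nonneg {A B a : ℝ} (hA : 1 ≤ A) (hB : 1 ≤ B * a) (hB0 : 0 ≤ B) (ha : 0 ≤ a)
    (f x q z : ℝ) : 0 ≤ energyDensity A B a f x q z := by
  unfold energyDensity
  have h1 : 0 ≤ A / 2 * (a * q ^ 2) := by positivity
  have h2 : 0 ≤ B / 2 * x ^ 2 := by positivity
  nlinarith [sq_nonneg (f - z), mul_le_mul_of_nonneg_right hA (sq_nonneg f),
    mul_le_mul_of_nonneg_right hB (sq_nonneg z)]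

theorem energyDensity_le {A B a M : ℝ} (hA : 0 ≤ A) (hB : 0 ≤ B) (ha : a ≤ M) (hM : 1 ≤ M)
    (f x q z : ℝ) :
    energyDensity A B a f x q z ≤ (A + B + 1) * M * (f ^ 2 + x ^ 2 + (q ^ 2 + z ^ 2)) := by
  unfold energyDensity
  have h1 : f ^ 2 + a * q ^ 2 ≤ M * (f ^ 2 + x ^ 2 + (q ^ 2 + z ^ 2)) := by
    nlinarith [sq_nonneg f, sq_nonneg x, sq_nonneg q, sq_nonneg z]
  have h2 : x ^ 2 + a * z ^ 2 ≤ M * (f ^ 2 + x ^ 2 + (q ^ 2 + z ^ 2)) := by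
    nlinarith [sq_nonneg f, sq_nonneg x, sq_nonneg q, sq_nonneg z]
  have h3 : -(f * z) ≤ M * (f ^ 2 + x ^ 2 + (q ^ 2 + z ^ 2)) := by
    nlinarith [sq_nonneg f, sq_nonneg x, sq_nonneg q, sq_nonneg z, sq_nonneg (f + z)]
  have h4 : 0 ≤ M * (f ^ 2 + x ^ 2 + (q ^ 2 + z ^ 2)) := by positivity
  nlinarith [mul_le_mul_of_nonneg_left h1 hA, mul_le_mul_of_nonneg_left h2 hB,
    mul_nonneg hA h4, mul_nonneg hB h4]

theorem abs_energyFlux_le {A B s k a f x q z P Q M ε : ℝ} (hA : 0 ≤ A) (hB : 0 ≤ B)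
    (hM : 1 ≤ M) (hε : 0 ≤ ε) (hε1 : ε ≤ 1) (hs : |s| ≤ M) (hk : |k| ≤ M) (ha : |a| ≤ M)
    (hf : |f| ≤ ε) (hx : |x| ≤ ε) (hq : |q| ≤ ε) (hz : |z| ≤ ε) (hP : |P| ≤ 6 * M)
    (hQ : |Q| ≤ 6 * M) :
    |energyFlux A B s k a f x q z P Q| ≤ 10 * (A + B + 1) * M ^ 2 * ε := by
  have hM0 : 0 ≤ M := by linarith
  have hMM : M ≤ M ^ 2 := by nlinarith
  have h12 : (1:ℝ) ≤ M ^ 2 := by nlinarith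
  have hee : ε * ε ≤ ε := by nlinarith
  have hsq : ∀ {c : ℝ}, |c| ≤ ε → |c ^ 2| ≤ ε := fun {c} hc => by
    rw [sq]
    exact (abs_mul_le_of_abs_le hc hc).trans hee
  have hs2 : |s / 2| ≤ M := by
    rw [abs_div, abs_two]
    linarith [abs_nonneg s]
  have c1 := (abs_mul_le_of_abs_le hs2 (hsq hf)).trans (mul_le_mul_of_nonneg_right hMM hε)
  have c2 : |k * f * x| ≤ M ^ 2 * ε := by
    rw [mul_assoc]
    refine (abs_mul_le_of_abs_le hk ((abs_mul_le_of_abs_le hf hx).trans hee)).trans ?_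
    gcongr
  have c3 : |s / 2 * a * q ^ 2| ≤ M ^ 2 * ε := by
    rw [sq M]
    exact abs_mul_le_of_abs_le (abs_mul_le_of_abs_le hs2 ha) (hsq hq)
  have c4 : |f * q| ≤ M ^ 2 * ε :=
    ((abs_mul_le_of_abs_le hf hq).trans hee).trans (by nlinarith)
  have c5 : |x * P| ≤ 6 * M ^ 2 * ε := (abs_mul_le_of_abs_le hx hP).trans (by nlinarith)
  have c6 := (abs_mul_le_of_abs_le hs2 (hsq hx)).trans (mul_le_mul_of_nonneg_right hMM hε)
  have c7 : |s / 2 * a * z ^ 2| ≤ M ^ 2 * ε := by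
    rw [sq M]
    exact abs_mul_le_of_abs_le (abs_mul_le_of_abs_le hs2 ha) (hsq hz)
  have c8 : |f * Q| ≤ 6 * M ^ 2 * ε := (abs_mul_le_of_abs_le hf hQ).trans (by nlinarith)
  have n : 0 ≤ M ^ 2 * ε := by positivity
  rw [abs_le] at *
  have dA : |s / 2 * f ^ 2 + k * f * x + s / 2 * a * q ^ 2 + f * q| ≤ 10 * M ^ 2 * ε := by
    rw [abs_le]; constructor <;> linarith
  have dB : |x * P - s / 2 * x ^ 2 + s / 2 * a * z ^ 2| ≤ 10 * M ^ 2 * ε := by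
    rw [abs_le]; constructor <;> linarith
  have gA := abs_le.1 (abs_mul_le_of_abs_le (abs_of_nonneg hA).le dA)
  have gB := abs_le.1 (abs_mul_le_of_abs_le (abs_of_nonneg hB).le dB)
  unfold energyFlux
  constructor <;> linarith

theorem energyFlux_hasDerivAt {A B s x₁ y z₁ z₂ P₁ Q₁ k₁ a₁ ξ : ℝ} {k a f x q z P Q : ℝ → ℝ}
    (hk : HasDerivAt k k₁ ξ) (ha : HasDerivAt a a₁ ξ) (hf : HasDerivAt f x₁ ξ)
    (hx : HasDerivAt x y ξ) (hq : HasDerivAt q z₁ ξ) (hz : HasDerivAt z z₂ ξ)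
    (hP : HasDerivAt P P₁ ξ) (hQ : HasDerivAt Q Q₁ ξ) :
    HasDerivAt (fun ξ => energyFlux A B s (k ξ) (a ξ) (f ξ) (x ξ) (q ξ) (z ξ) (P ξ) (Q ξ))
      (A * (s * f ξ * x₁ + (k₁ * f ξ * x ξ + k ξ * x₁ * x ξ + k ξ * f ξ * y)
          + (s / 2 * a₁ * q ξ ^ 2 + s * a ξ * q ξ * z₁) + (x₁ * q ξ + f ξ * z₁))
        + B * (y * P ξ + x ξ * P₁ - s * x ξ * y + (s / 2 * a₁ * z ξ ^ 2 + s * a ξ * z ξ * z₂))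
        - (x₁ * Q ξ + f ξ * Q₁)) ξ := by
  have h := (((((((hf.pow 2).const_mul (s / 2)).add ((hk.mul hf).mul hx)).add
    ((ha.const_mul (s / 2)).mul (hq.pow 2))).add (hf.mul hq)).const_mul A).add
    ((((hx.mul hP).sub ((hx.pow 2).const_mul (s / 2))).add
      ((ha.const_mul (s / 2)).mul (hz.pow 2))).const_mul B)).sub (hf.mul hQ)
  refine (h.congr_deriv ?_)
  simp
  ring

theorem energyDensity_hasDerivAt {A B a f₁ x₁ q₁ z₁ τ : ℝ} {f x q z : ℝ → ℝ}
    (hf : HasDerivAt f f₁ τ) (hx : HasDerivAt x x₁ τ) (hq : HasDerivAt q q₁ τ)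
    (hz : HasDerivAt z z₁ τ) :
    HasDerivAt (fun τ => energyDensity A B a (f τ) (x τ) (q τ) (z τ))
      (A * (f τ * f₁ + a * q τ * q₁) + B * (x τ * x₁ + a * z τ * z₁)
        - (f₁ * z τ + f τ * z₁)) τ := by
  have h := ((((hf.pow 2).add ((hq.pow 2).const_mul a)).const_mul (A / 2)).add
    (((hx.pow 2).add ((hz.pow 2).const_mul a)).const_mul (B / 2))).sub (hf.mul hz)
  refine (h.congr_deriv ?_)
  simp
  ring
theorem abs_Gterm_le {p g tv : ℝ → ℝ} {s r m M : ℝ} (hc : CoefficientBounds p g tv s r m M)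
    (φ : ℝ → ℝ) (ξ : ℝ) (hx : |deriv φ ξ| ≤ r) :
    |Gterm g tv φ ξ| ≤ M * (|deriv φ ξ| * (|deriv φ ξ| + |iteratedDeriv 2 φ ξ|)) := by
  have h := (abs_add_le _ _).trans (add_le_add
    (abs_mul_le_of_abs_le (hc.visc_lip ξ _ hx) (le_refl |iteratedDeriv 2 φ ξ|))
    (hc.visc_taylor ξ _ hx))
  refine h.trans (le_of_eq ?_)
  rw [← sq_abs]
  ring

theorem prel_hasDerivAt {p g tv : ℝ → ℝ} {s r m M : ℝ} (hc : CoefficientBounds p g tv s r m M)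
    (φ : ℝ → ℝ) (ξ : ℝ) (hx : |deriv φ ξ| ≤ r) (hr : 0 ≤ r)
    (hφ : HasDerivAt (deriv φ) (iteratedDeriv 2 φ ξ) ξ) :
    HasDerivAt (prel p tv φ) ((deriv p (tv ξ + deriv φ ξ) - deriv p (tv ξ)) * iteratedDeriv 2 φ ξ
      + (deriv p (tv ξ + deriv φ ξ) - deriv p (tv ξ) - deriv (deriv p) (tv ξ) * deriv φ ξ)
        * deriv tv ξ) ξ := by
  have h0 : HasDerivAt p (deriv p (tv ξ)) (tv ξ) := by
    simpa using hc.pres_diff ξ 0 (by simpa using hr)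
  have h := (((hc.pres_diff ξ _ hx).comp ξ ((hc.profile ξ).add hφ)).sub
    (h0.comp ξ (hc.profile ξ))).sub (((hc.pres_diff2 ξ).comp ξ (hc.profile ξ)).mul hφ)
  refine h.congr_deriv ?_
  simp only [Function.comp]
  ring

theorem weight_hasDerivAt {p g tv : ℝ → ℝ} {s r m M : ℝ}
    (hc : CoefficientBounds p g tv s r m M) (ξ : ℝ) :
    HasDerivAt (fun ξ => (-deriv p (tv ξ))⁻¹)
      ((-deriv p (tv ξ))⁻¹ ^ 2 * (deriv (deriv p) (tv ξ) * deriv tv ξ)) ξ := by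
  have h := (((hc.pres_diff2 ξ).comp ξ (hc.profile ξ)).neg).inv
    (by simpa using (hc.pres_neg ξ).ne)
  refine h.congr_deriv ?_
  simp only [Function.comp, Pi.neg_apply]
  have := (hc.pres_neg ξ).ne
  field_simp

/-- Sobolev embedding for a component of a pair that is small in `H³`. -/
theorem abs_le_of_pairHkSq_le {f q : ℝ → ℝ} (hf : ContDiff ℝ 4 f)
    (hfi : ∀ j ≤ 4, Integrable fun ξ => iteratedDeriv j f ξ ^ 2)
    (hlim : ∀ j ≤ 3, Tendsto (iteratedDeriv j f) atBot (𝓝 0))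
    {η : ℝ} (hη : 0 ≤ η) (h : HkSq 3 f + HkSq 3 q ≤ η ^ 2) {j : ℕ} (hj : j ≤ 2) (ξ : ℝ) :
    |iteratedDeriv j f ξ| ≤ η := by
  refine abs_le_of_sq_le_sq ?_ hη
  refine le_trans ?_ h
  have nn : ∀ w : ℝ → ℝ, 0 ≤ L2sq w := fun w => integral_nonneg fun ξ => sq_nonneg _
  have hq : 0 ≤ HkSq 3 q := Finset.sum_nonneg fun j _ => nn _
  have hfj : ContDiff ℝ 1 (iteratedDeriv j f) := by
    rw [iteratedDeriv_eq_iterate]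
    refine ContDiff.iterate_deriv' 1 j (hf.of_le ?_)
    norm_cast
    omega
  have h1 := sq_le_L2sq_add_L2sq_deriv hfj (hfi j (by omega))
    (by simpa only [iteratedDeriv_succ] using hfi (j + 1) (by omega)) (hlim j (by omega)) ξ
  have h2 : L2sq (iteratedDeriv j f) + L2sq (deriv (iteratedDeriv j f)) ≤ HkSq 3 f := by
    rw [← iteratedDeriv_succ]
    simp only [HkSq, Finset.sum_range_succ, Finset.sum_range_zero]
    interval_cases j <;>
      linarith [nn (iteratedDeriv 0 f), nn (iteratedDeriv 1 f), nn (iteratedDeriv 2 f),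
        nn (iteratedDeriv 3 f)]
  linarith

/-- The estimate of `Ψ_ξ` for the weighted energy with weights `A` and `B`, under explicit smallness
conditions on the bound `η` of the perturbation. -/
theorem psi_xi_estimate_of_coefficientBounds {p g tv : ℝ → ℝ} {s r m M A B η T δ : ℝ}
    {Φ Ψ : ℝ → ℝ → ℝ} (hc : CoefficientBounds p g tv s r m M) (hr : 0 ≤ r)
    (hη : 0 ≤ η) (hη1 : η ≤ 1) (hηr : η ≤ r)
    (hA1 : 1 ≤ A) (hBM : M ≤ B) (hB : 4 * M ^ 2 ≤ B * m)
    (hA : 2 * (B * (M ^ 2 / m) + M ^ 2 * (1 + B) ^ 2 + M) ≤ A * m)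
    (hηA : η * (10 * (A + B + 1) * M ^ 2) ≤ A * m / 2)
    (hηB : η * (10 * (A + B + 1) * M ^ 2) ≤ B * m / 2)
    (hT : 0 < T) (hδ : δ ≤ η) (sol : IsClassicalSolution p g tv s T Φ Ψ)
    (hsmall : ∀ t ∈ Icc (0:ℝ) T, Real.sqrt (pairHkSq 3 (Φ t) (Ψ t)) ≤ δ)
    {t : ℝ} (ht : t ∈ Icc (0:ℝ) T) :
    ∫ τ in (0:ℝ)..t, L2sq (deriv (Ψ τ)) ≤
      2 * ((A + B + 1) * M) * pairHkSq 1 (Φ 0) (Ψ 0) := by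
  have hM := hc.one_le
  have hM0 : 0 ≤ M := by linarith
  have hA0 : 0 ≤ A := by linarith
  have hB0 : 0 ≤ B := by linarith
  have h0T : (0:ℝ) ∈ Icc 0 T := ⟨le_rfl, hT.le⟩
  have hle : Icc 0 t ⊆ Icc 0 T := Icc_subset_Icc_right ht.2
  -- spatial derivatives
  have hsp : ∀ f : ℝ → ℝ, ContDiff ℝ 4 f → ∀ ξ, HasDerivAt f (deriv f ξ) ξ ∧
      HasDerivAt (deriv f) (iteratedDeriv 2 f ξ) ξ := by
    intro f hf ξ
    refine ⟨(hf.differentiable (by simp) ξ).hasDerivAt, ?_⟩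
    have h3 : ContDiff ℝ 3 (deriv f) := (contDiff_succ_iff_deriv (n := 3).1 hf).2.2
    rw [iteratedDeriv_succ, iteratedDeriv_one]
    exact (h3.differentiable (by simp) ξ).hasDerivAt
  have hcd : ∀ f : ℝ → ℝ, ContDiff ℝ 4 f → Continuous (deriv f) := fun f hf =>
    hf.continuous_deriv (by simp)
  -- pointwise smallness
  have hsq : ∀ τ ∈ Icc 0 T, pairHkSq 3 (Φ τ) (Ψ τ) ≤ η ^ 2 := fun τ hτ =>
    (Real.sqrt_le_left hη).1 ((hsmall τ hτ).trans hδ)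
  have htend : ∀ f : ℝ → ℝ, (∀ ε > (0:ℝ), ∃ R : ℝ, ∀ ξ, R ≤ |ξ| → |f ξ| < ε) →
      Tendsto f atBot (𝓝 0) := by
    intro f hf
    rw [Metric.tendsto_nhds]
    intro ε hε
    obtain ⟨R, hR⟩ := hf ε hε
    filter_upwards [eventually_le_atBot (-R)] with ξ hξ
    rw [Real.dist_eq, sub_zero]
    exact hR ξ ((le_neg_of_le_neg hξ).trans (neg_le_abs ξ))
  have hΦs : ∀ τ ∈ Icc 0 T, ∀ j ≤ 2, ∀ ξ, |iteratedDeriv j (Φ τ) ξ| ≤ η := fun τ hτ j hj ξ =>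
    abs_le_of_pairHkSq_le (sol.regΦ τ hτ) (fun i hi => sol.sqIntΦ i hi τ hτ)
      (fun i hi => htend _ fun ε hε => (sol.decayΦ i hi ε hε).imp fun R hR => hR τ hτ) hη
      (hsq τ hτ) hj ξ
  have hΨs : ∀ τ ∈ Icc 0 T, ∀ j ≤ 2, ∀ ξ, |iteratedDeriv j (Ψ τ) ξ| ≤ η := fun τ hτ j hj ξ =>
    abs_le_of_pairHkSq_le (sol.regΨ τ hτ) (fun i hi => sol.sqIntΨ i hi τ hτ)
      (fun i hi => htend _ fun ε hε => (sol.decayΨ i hi ε hε).imp fun R hR => hR τ hτ) hη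
      (q := Φ τ) ((add_comm _ _).trans_le (hsq τ hτ)) hj ξ
  have bf : ∀ τ ∈ Icc 0 T, ∀ ξ, |Φ τ ξ| ≤ η := fun τ hτ ξ => by
    simpa using hΦs τ hτ 0 (by norm_num) ξ
  have bx : ∀ τ ∈ Icc 0 T, ∀ ξ, |deriv (Φ τ) ξ| ≤ η := fun τ hτ ξ => by
    simpa using hΦs τ hτ 1 (by norm_num) ξ
  have bq : ∀ τ ∈ Icc 0 T, ∀ ξ, |Ψ τ ξ| ≤ η := fun τ hτ ξ => by
    simpa using hΨs τ hτ 0 (by norm_num) ξ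
  have bz : ∀ τ ∈ Icc 0 T, ∀ ξ, |deriv (Ψ τ) ξ| ≤ η := fun τ hτ ξ => by
    simpa using hΨs τ hτ 1 (by norm_num) ξ
  have by2 : ∀ τ ∈ Icc 0 T, ∀ ξ, |iteratedDeriv 2 (Φ τ) ξ| ≤ η := fun τ hτ ξ =>
    hΦs τ hτ 2 le_rfl ξ
  -- time derivatives
  have tf : ∀ τ ∈ Icc 0 T, ∀ ξ,
      HasDerivAt (fun σ => Φ σ ξ) (deriv (fun σ => Φ σ ξ) τ) τ := fun τ hτ ξ => by
    simpa using (sol.tdiffΦ 0 (by norm_num) τ hτ ξ).hasDerivAt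
  have tx : ∀ τ ∈ Icc 0 T, ∀ ξ,
      HasDerivAt (fun σ => deriv (Φ σ) ξ) (deriv (fun σ => deriv (Φ σ) ξ) τ) τ :=
    fun τ hτ ξ => by simpa using (sol.tdiffΦ 1 (by norm_num) τ hτ ξ).hasDerivAt
  have tq : ∀ τ ∈ Icc 0 T, ∀ ξ,
      HasDerivAt (fun σ => Ψ σ ξ) (deriv (fun σ => Ψ σ ξ) τ) τ := fun τ hτ ξ => by
    simpa using (sol.tdiffΨ 0 (by norm_num) τ hτ ξ).hasDerivAt
  have tz : ∀ τ ∈ Icc 0 T, ∀ ξ,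
      HasDerivAt (fun σ => deriv (Ψ σ) ξ) (deriv (fun σ => deriv (Ψ σ) ξ) τ) τ :=
    fun τ hτ ξ => by simpa using (sol.tdiffΨ 1 (by norm_num) τ hτ ξ).hasDerivAt
  -- joint continuity
  have cf := sol.spContΦ 0 (by norm_num)
  have cx := sol.spContΦ 1 (by norm_num)
  have cq := sol.spContΨ 0 (by norm_num)
  have cz := sol.spContΨ 1 (by norm_num)
  have cft := sol.mixContΦ 0 (by norm_num)
  have cxt := sol.mixContΦ 1 (by norm_num)
  have cqt := sol.mixContΨ 0 (by norm_num)
  have czt := sol.mixContΨ 1 (by norm_num)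
  simp only [iteratedDeriv_zero, iteratedDeriv_one] at cf cx cq cz cft cxt cqt czt
  have hsub : Icc (0:ℝ) t ×ˢ (univ : Set ℝ) ⊆ Icc 0 T ×ˢ univ := prod_mono_left hle
  have ca : ContinuousOn (fun q : ℝ × ℝ => (-deriv p (tv q.2))⁻¹) (Icc 0 t ×ˢ univ) := by
    have h1 : Continuous fun ξ => (-deriv p (tv ξ))⁻¹ :=
      continuous_iff_continuousAt.2 fun ξ => (weight_hasDerivAt hc ξ).continuousAt
    exact (h1.comp continuous_snd).continuousOn
  have hapos : ∀ ξ, 0 < (-deriv p (tv ξ))⁻¹ := fun ξ => inv_pos.2 (neg_pos.2 (hc.pres_neg ξ))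
  have haM : ∀ ξ, |(-deriv p (tv ξ))⁻¹| ≤ M := fun ξ => by
    rw [abs_of_pos (hapos ξ)]
    exact hc.weight_bound ξ
  have hBa : ∀ ξ, 1 ≤ B * (-deriv p (tv ξ))⁻¹ := fun ξ => by
    rw [← div_eq_mul_inv, one_le_div (neg_pos.2 (hc.pres_neg ξ))]
    exact ((neg_le_abs _).trans (hc.pres_bound ξ)).trans hBM
  have hprel : ∀ τ ∈ Icc 0 T, ∀ ξ, |prel p tv (Φ τ) ξ| ≤ M * |deriv (Φ τ) ξ| ^ 2 :=
    fun τ hτ ξ => by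
      rw [sq_abs]
      exact hc.pres_taylor ξ _ ((bx τ hτ ξ).trans hηr)
  have key := dissipation_estimate (t := t)
    (e := fun τ ξ => energyDensity A B (-deriv p (tv ξ))⁻¹ (Φ τ ξ) (deriv (Φ τ) ξ) (Ψ τ ξ)
      (deriv (Ψ τ) ξ))
    (w := fun τ ξ => 1 / 2 * deriv (Ψ τ) ξ ^ 2)
    (F := fun τ ξ => energyFlux A B s (deriv g (tv ξ)) (-deriv p (tv ξ))⁻¹ (Φ τ ξ)
      (deriv (Φ τ) ξ) (Ψ τ ξ) (deriv (Ψ τ) ξ) (deriv (fun σ => Φ σ ξ) τ)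
      (deriv (fun σ => Ψ σ ξ) τ))
    (h0 := fun ξ => (A + B + 1) * M * (Φ 0 ξ ^ 2 + deriv (Φ 0) ξ ^ 2
      + (Ψ 0 ξ ^ 2 + deriv (Ψ 0) ξ ^ 2))) ht.1 ?_ ?_
    (fun τ hτ ξ => energyDensity_hasDerivAt (tf τ (hle hτ) ξ) (tx τ (hle hτ) ξ)
      (tq τ (hle hτ) ξ) (tz τ (hle hτ) ξ))
    (fun τ hτ ξ => energyFlux_hasDerivAt ((hc.visc_diff ξ).comp ξ (hc.profile ξ))
      (weight_hasDerivAt hc ξ) (hsp _ (sol.regΦ τ (hle (Ioo_subset_Icc_self hτ))) ξ).1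
      (hsp _ (sol.regΦ τ (hle (Ioo_subset_Icc_self hτ))) ξ).2
      (hsp _ (sol.regΨ τ (hle (Ioo_subset_Icc_self hτ))) ξ).1
      (hsp _ (sol.regΨ τ (hle (Ioo_subset_Icc_self hτ))) ξ).2
      (hasDerivAt_comm_of_continuousOn (fun σ hσ ξ => (hsp _ (sol.regΦ σ hσ) ξ).1)
        (fun σ hσ => hcd _ (sol.regΦ σ hσ)) tf tx cxt ⟨hτ.1, hτ.2.trans_le ht.2⟩ ξ)
      (hasDerivAt_comm_of_continuousOn (fun σ hσ ξ => (hsp _ (sol.regΨ σ hσ) ξ).1)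
        (fun σ hσ => hcd _ (sol.regΨ σ hσ)) tq tz czt ⟨hτ.1, hτ.2.trans_le ht.2⟩ ξ))
    ?_ ?_
    (fun ξ => energyDensity_nonneg hA1 (hBa ξ) hB0 (hapos ξ).le _ _ _ _)
    (fun ξ => energyDensity_le hA0 hB0 (hc.weight_bound ξ) hM _ _ _ _)
    ?_ (fun ξ => by positivity) (fun τ ξ => by positivity) ?_ ?_
  · have i0 := sol.sqIntΦ 0 (by norm_num) 0 h0T
    have i1 := sol.sqIntΦ 1 (by norm_num) 0 h0T
    have i2 := sol.sqIntΨ 0 (by norm_num) 0 h0T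
    have i3 := sol.sqIntΨ 1 (by norm_num) 0 h0T
    simp only [iteratedDeriv_zero, iteratedDeriv_one] at i0 i1 i2 i3
    have hsum := (integral_add (i0.add i1) (i2.add i3)).trans
      (congrArg₂ (· + ·) (integral_add i0 i1) (integral_add i2 i3))
    simp only [Pi.add_apply] at hsum
    simp only [integral_const_mul, intervalIntegral.integral_const_mul, hsum] at key
    simp only [pairHkSq, HkSq, L2sq, Finset.sum_range_succ, Finset.sum_range_zero,
      iteratedDeriv_zero, iteratedDeriv_one]
    linarith
  · have := cf.mono hsub
    have := cx.mono hsub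
    have := cq.mono hsub
    have := cz.mono hsub
    have := cft.mono hsub
    have := cxt.mono hsub
    have := cqt.mono hsub
    have := czt.mono hsub
    fun_prop
  · have := cz.mono hsub
    fun_prop
  · intro τ hτ ξ
    have hτT := hle (Ioo_subset_Icc_self hτ)
    have hxr : |deriv (Φ τ) ξ| ≤ r := (bx τ hτT ξ).trans hηr
    have hΦd := hsp _ (sol.regΦ τ hτT) ξ
    have hΨd := hsp _ (sol.regΨ τ hτT) ξ
    have hQ' := hasDerivAt_comm_of_continuousOn (fun σ hσ ξ => (hsp _ (sol.regΨ σ hσ) ξ).1)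
        (fun σ hσ => hcd _ (sol.regΨ σ hσ)) tq tz czt
        (show τ ∈ Ioo 0 T from ⟨hτ.1, hτ.2.trans_le ht.2⟩) ξ
    have e1 := sol.eq1 τ hτT ξ
    have e2 := sol.eq2 τ hτT ξ
    have hrhs := ((hΨd.2.const_mul s).sub
      (((hc.pres_diff2 ξ).comp ξ (hc.profile ξ)).mul hΦd.2)).sub
      (prel_hasDerivAt hc (Φ τ) ξ hxr hr hΦd.2)
    have e3 := hQ'.unique (hrhs.congr_of_eventuallyEq (Eventually.of_forall fun y => by
      have := sol.eq2 τ hτT y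
      simp only [Pi.sub_apply, Pi.mul_apply, Function.comp]
      linarith))
    simp only [Function.comp] at e3
    have hprd : |(deriv p (tv ξ + deriv (Φ τ) ξ) - deriv p (tv ξ)) * iteratedDeriv 2 (Φ τ) ξ
        + (deriv p (tv ξ + deriv (Φ τ) ξ) - deriv p (tv ξ)
          - deriv (deriv p) (tv ξ) * deriv (Φ τ) ξ) * deriv tv ξ|
        ≤ M * (|deriv (Φ τ) ξ| * (|deriv (Φ τ) ξ| + |iteratedDeriv 2 (Φ τ) ξ|)) := by
      have h := (abs_add_le _ _).trans (add_le_add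
        (abs_mul_le_of_abs_le (hc.pres_lip ξ _ hxr) (le_refl |iteratedDeriv 2 (Φ τ) ξ|))
        (hc.pres_deriv_taylor ξ _ hxr))
      refine h.trans (le_of_eq ?_)
      rw [← sq_abs]
      ring
    have hs1 : 0 ≤ s * ((-deriv p (tv ξ))⁻¹ ^ 2 * (deriv (deriv p) (tv ξ) * deriv tv ξ)) := by
      have := mul_nonneg (sq_nonneg (-deriv p (tv ξ))⁻¹) (hc.weight_sign ξ)
      linarith
    have hd := dissipation_le (f := Φ τ ξ) (q := Ψ τ ξ) (z := deriv (Ψ τ) ξ) hc.m_pos hM hη hA0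
      hB0 hB hA hηA hηB (hc.visc_lower ξ) (hc.visc_upper ξ) (hc.visc_deriv ξ) (haM ξ)
      (hc.weight_deriv ξ) (hc.pres_bound ξ) hs1 (abs_Gterm_le hc (Φ τ) ξ hxr)
      (hprel τ hτT ξ) hprd (bf τ hτT ξ) (bq τ hτT ξ) (bx τ hτT ξ) (bz τ hτT ξ)
    have hap : (-deriv p (tv ξ))⁻¹ * deriv p (tv ξ) = -1 := by
      have := (hc.pres_neg ξ).ne
      field_simp
    linear_combination hd
      + (A * Φ τ ξ - B * iteratedDeriv 2 (Φ τ) ξ - deriv (Ψ τ) ξ) * e1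
      + (A * (-deriv p (tv ξ))⁻¹ * Ψ τ ξ + deriv (Φ τ) ξ) * e2
      + B * (-deriv p (tv ξ))⁻¹ * deriv (Ψ τ) ξ * e3
      - (A * Ψ τ ξ * deriv (Φ τ) ξ + B * deriv (Ψ τ) ξ * iteratedDeriv 2 (Φ τ) ξ) * hap
  · intro ε hε
    obtain ⟨R0, hR0⟩ := sol.decayΦ 0 (by norm_num)
      (min 1 (ε / (10 * (A + B + 1) * M ^ 2))) (by positivity)
    obtain ⟨R1, hR1⟩ := sol.decayΦ 1 (by norm_num)
      (min 1 (ε / (10 * (A + B + 1) * M ^ 2))) (by positivity)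
    obtain ⟨R2, hR2⟩ := sol.decayΨ 0 (by norm_num)
      (min 1 (ε / (10 * (A + B + 1) * M ^ 2))) (by positivity)
    obtain ⟨R3, hR3⟩ := sol.decayΨ 1 (by norm_num)
      (min 1 (ε / (10 * (A + B + 1) * M ^ 2))) (by positivity)
    simp only [iteratedDeriv_zero, iteratedDeriv_one] at hR0 hR1 hR2 hR3
    refine ⟨max (max R0 R1) (max R2 R3), fun τ hτ ξ hξ => ?_⟩
    have hτT := hle (Ioo_subset_Icc_self hτ)
    simp only [max_le_iff] at hξ
    have hx1 := (bx τ hτT ξ).trans hη1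
    have hy1 := (by2 τ hτT ξ).trans hη1
    have hz1 := (bz τ hτT ξ).trans hη1
    have hsx := abs_le.1 (abs_mul_le_of_abs_le hc.speed hx1)
    have hsz := abs_le.1 (abs_mul_le_of_abs_le hc.speed hz1)
    refine (abs_energyFlux_le (ε := min 1 (ε / (10 * (A + B + 1) * M ^ 2))) hA0 hB0 hM
      (by positivity) (min_le_left _ _) hc.speed
      (hc.visc_upper ξ) (haM ξ) (hR0 τ hτT ξ hξ.1.1).le (hR1 τ hτT ξ hξ.1.2).le
      (hR2 τ hτT ξ hξ.2.1).le (hR3 τ hτT ξ hξ.2.2).le ?_ ?_).trans ?_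
    · have e1 := sol.eq1 τ hτT ξ
      have h1 := abs_le.1 (abs_mul_le_of_abs_le (hc.visc_upper ξ) hy1)
      have h2 := abs_le.1 (abs_mul_le_of_abs_le (hc.visc_deriv ξ) hx1)
      have h3 : |Gterm g tv (Φ τ) ξ| ≤ M * (1 * (1 + 1)) :=
        (abs_Gterm_le hc (Φ τ) ξ ((bx τ hτT ξ).trans hηr)).trans (by gcongr)
      have h3 := abs_le.1 h3
      have h4 := abs_le.1 hz1
      rw [abs_le]
      constructor <;> linarith
    · have e2 := sol.eq2 τ hτT ξ
      have h1 := abs_le.1 (abs_mul_le_of_abs_le (hc.pres_bound ξ) hx1)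
      have h2 : |prel p tv (Φ τ) ξ| ≤ M * 1 ^ 2 := (hprel τ hτT ξ).trans (by gcongr)
      have h2 := abs_le.1 h2
      rw [abs_le]
      constructor <;> linarith
    · calc _ ≤ 10 * (A + B + 1) * M ^ 2 * (ε / (10 * (A + B + 1) * M ^ 2)) := by
            gcongr
            exact min_le_right _ _
        _ = ε := by
            have : (0:ℝ) < 10 * (A + B + 1) * M ^ 2 := by positivity
            field_simp
  · have i0 := sol.sqIntΦ 0 (by norm_num) 0 h0T
    have i1 := sol.sqIntΦ 1 (by norm_num) 0 h0T
    have i2 := sol.sqIntΨ 0 (by norm_num) 0 h0T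
    have i3 := sol.sqIntΨ 1 (by norm_num) 0 h0T
    simp only [iteratedDeriv_zero, iteratedDeriv_one] at i0 i1 i2 i3
    exact ((i0.add i1).add (i2.add i3)).const_mul _
  · intro τ hτ
    simpa using (sol.sqIntΨ 1 (by norm_num) τ (hle hτ)).const_mul (1 / 2)
  · simp only [integral_const_mul]
    have := (sol.l2ContΨ 1 (by norm_num)).mono hle
    simp only [iteratedDeriv_one, L2sq] at this
    fun_prop

theorem psi_xi_estimate
    (p : ℝ → ℝ)
    (hp_smooth : ContDiffOn ℝ (⊤ : ℕ∞) p (Set.Ioi 0))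
    (hpd : ∀ v ∈ Set.Ioi (0:ℝ), deriv p v < 0)
    (hpdd : ∀ v ∈ Set.Ioi (0:ℝ), 0 ≤ deriv (deriv p) v)
    (hpdd_ne : ∀ a b : ℝ, 0 < a → a < b → ∃ v ∈ Set.Ioo a b, deriv (deriv p) v ≠ 0)
    (μ : ℝ → ℝ)
    (hmu_smooth : ContDiffOn ℝ (⊤ : ℕ∞) μ (Set.Ioi 0))
    (hmu_pos : ∀ v ∈ Set.Ioi (0:ℝ), 0 < μ v)
    (vp vm s : ℝ)
    (hvp : 0 < vp) (hvpvm : vp < vm)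
    (hs : s = -Real.sqrt (-((p vp - p vm) / (vp - vm))))
    (hsneg : s < 0)
    (g : ℝ → ℝ)
    (hg : ∀ z ∈ Set.Ioi (0:ℝ), HasDerivAt g (μ z / z) z)
    (tv : ℝ → ℝ)
    (htv_smooth : ContDiff ℝ (⊤ : ℕ∞) tv)
    (htv_ode : ∀ ξ : ℝ, deriv tv ξ
        = tv ξ / (-s * μ (tv ξ)) * (s ^ 2 * (tv ξ - vm) + p (tv ξ) - p vm))
    (htv_mem : ∀ ξ : ℝ, tv ξ ∈ Set.Ioo vp vm)
    (htv_dec : ∀ ξ : ℝ, deriv tv ξ < 0)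
    (htv_bot : Filter.Tendsto tv Filter.atBot (nhds vm))
    (htv_top : Filter.Tendsto tv Filter.atTop (nhds vp))
    (htv_bdd : ∀ k : ℕ, ∃ M : ℝ, ∀ ξ : ℝ, |iteratedDeriv k tv ξ| ≤ M)
 :
    ∃ δ₀ > (0:ℝ), ∃ C > (0:ℝ), ∀ T > (0:ℝ), ∀ δ ≤ δ₀, ∀ Φ Ψ : ℝ → ℝ → ℝ,
      IsClassicalSolution p g tv s T Φ Ψ →
      (∀ t ∈ Set.Icc (0:ℝ) T, Real.sqrt (pairHkSq 3 (Φ t) (Ψ t)) ≤ δ) →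
      ∀ t ∈ Set.Icc (0:ℝ) T,
        (∫ τ in (0:ℝ)..t, L2sq (deriv (Ψ τ))) ≤ C * pairHkSq 1 (Φ 0) (Ψ 0) := by
  obtain ⟨m, M, hc⟩ := exists_coefficientBounds hp_smooth hpd hpdd hmu_smooth hmu_pos hvp hsneg hg
    htv_smooth htv_mem htv_dec (by simpa using htv_bdd 1)
  have hm := hc.m_pos
  have hM : 0 < M := by linarith [hc.one_le]
  obtain ⟨B, hBM, hB⟩ : ∃ B, M ≤ B ∧ 4 * M ^ 2 ≤ B * m :=
    ⟨max M (4 * M ^ 2 / m), le_max_left _ _, (div_le_iff₀ hm).1 (le_max_right _ _)⟩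
  obtain ⟨A, hA1, hA⟩ : ∃ A, 1 ≤ A ∧
      2 * (B * (M ^ 2 / m) + M ^ 2 * (1 + B) ^ 2 + M) ≤ A * m :=
    ⟨max 1 (2 * (B * (M ^ 2 / m) + M ^ 2 * (1 + B) ^ 2 + M) / m), le_max_left _ _,
      (div_le_iff₀ hm).1 (le_max_right _ _)⟩
  have hA0 : 0 < A := by linarith
  have hB0 : 0 < B := by linarith
  have hN : 0 < 10 * (A + B + 1) * M ^ 2 := by positivity
  obtain ⟨η, hη, hη1, hηr, hηA, hηB⟩ : ∃ η > 0, η ≤ 1 ∧ η ≤ vp / 2 ∧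
      η * (10 * (A + B + 1) * M ^ 2) ≤ A * m / 2 ∧
      η * (10 * (A + B + 1) * M ^ 2) ≤ B * m / 2 := by
    refine ⟨min (min 1 (vp / 2)) (min (A * m / 2 / (10 * (A + B + 1) * M ^ 2))
      (B * m / 2 / (10 * (A + B + 1) * M ^ 2))), by positivity, ?_, ?_, ?_, ?_⟩
    · exact (min_le_left _ _).trans (min_le_left _ _)
    · exact (min_le_left _ _).trans (min_le_right _ _)
    · exact (le_div_iff₀ hN).1 ((min_le_right _ _).trans (min_le_left _ _))
    · exact (le_div_iff₀ hN).1 ((min_le_right _ _).trans (min_le_right _ _))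
  exact ⟨η, hη, 2 * ((A + B + 1) * M), by positivity, fun T hT δ hδ Φ Ψ sol hsmall t ht =>
    psi_xi_estimate_of_coefficientBounds hc (by positivity) hη.le hη1 hηr hA1 hBM hB hA hηA hηB
      hT hδ sol hsmall ht⟩
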